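/- arXiv:math/0207041 — 2 statements merged into one kernel-verified Lean document; each statement's English description precedes it below -/
import Mathlib

section
/- Let B° = {w ∈ B : w^S_n > 0 for every nonempty S ⊆ {1,…,d} and every n ∈ S}. Then B equals the closure of B° in Π_{∅≠S⊆{1,…,d}} ℝ^d; in particular, B is closed and every point of B is a limit of points of B°. -/
noncomputable section
open Polynomial Filter Topology ENNReal

/-- The inner product `⟨p,q⟩_v = ∑ₖ p(μₖ)q(μₖ)vₖ`. -/
def ip {m : ℕ} (μ v : Fin m → ℝ) (p q : ℝ[X]) : ℝ :=
  ∑ k, p.eval (μ k) * q.eval (μ k) * v k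

/-- Pair `(pₙ, pₙ₋₁)` of monic orthogonal polynomials (with `p₋₁ = 0`). -/
def opAux {m : ℕ} (μ v : Fin m → ℝ) : ℕ → ℝ[X] × ℝ[X]
  | 0 => (1, 0)
  | n + 1 =>
    let P := opAux μ v n
    ((X - C (ip μ v P.1 (X * P.1) / ip μ v P.1 P.1)) * P.1
        - C (ip μ v P.1 P.1 / ip μ v P.2 P.2) * P.2, P.1)

/-- The `n`-th monic orthogonal polynomial of the recursion. -/
def op {m : ℕ} (μ v : Fin m → ℝ) (n : ℕ) : ℝ[X] := (opAux μ v n).1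

/-- The entry `a_N` of the Jacobi matrix construction: for odd `N = 2n+1` the diagonal
entry `a_{2n+1} = ⟨pₙ, Xpₙ⟩/⟨pₙ,pₙ⟩`, for even `N = 2n` the off-diagonal entry
`a_{2n} = √(⟨pₙ,pₙ⟩/⟨pₙ₋₁,pₙ₋₁⟩)`. -/
def fEnt {m : ℕ} (μ v : Fin m → ℝ) (N : ℕ) : ℝ :=
  if N % 2 = 1 then
    ip μ v (op μ v (N / 2)) (X * op μ v (N / 2)) / ip μ v (op μ v (N / 2)) (op μ v (N / 2))
  else
    Real.sqrt (ip μ v (op μ v (N / 2)) (op μ v (N / 2)) /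
      ip μ v (op μ v (N / 2 - 1)) (op μ v (N / 2 - 1)))

/-- The symmetric tridiagonal matrix `f(μ, v)` with diagonal `a₁,a₃,…` and
sub/super-diagonal `a₂,a₄,…`. -/
def Jmat {m : ℕ} (μ v : Fin m → ℝ) : Matrix (Fin m) (Fin m) ℝ :=
  Matrix.of fun i j =>
    if i = j then fEnt μ v (2 * (i : ℕ) + 1)
    else if (i : ℕ) + 1 = (j : ℕ) ∨ (j : ℕ) + 1 = (i : ℕ) then fEnt μ v ((i : ℕ) + (j : ℕ) + 1)
    else 0

/-- Restriction of `g : Fin d → ℝ` to a subset `Q`, reindexed in increasing order. -/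
def restr {d : ℕ} (Q : Finset (Fin d)) (g : Fin d → ℝ) : Fin Q.card → ℝ :=
  fun k => g ((Q.orderIsoOfFin rfl) k).1

/-- Leading `i × i` principal submatrix. -/
def leadSub {d : ℕ} (J : Matrix (Fin d) (Fin d) ℝ) (i : ℕ) (h : i ≤ d) :
    Matrix (Fin i) (Fin i) ℝ :=
  Matrix.of fun a b => J ⟨a.1, lt_of_lt_of_le a.2 h⟩ ⟨b.1, lt_of_lt_of_le b.2 h⟩

/-- A sequence of positive weight vectors is stable if all pairwise ratios converge
in `[0,∞]`. -/
def Stable {d : ℕ} (w : ℕ → Fin d → ℝ) : Prop :=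
  (∀ n i, 0 < w n i) ∧
    ∀ i j : Fin d, ∃ L : ℝ≥0∞,
      Tendsto (fun n => ENNReal.ofReal (w n i / w n j)) atTop (𝓝 L)

/-- `S : Fin r → Finset (Fin d)` is an ordered partition of `{0,…,d-1}`. -/
def OrdPart {d r : ℕ} (S : Fin r → Finset (Fin d)) : Prop :=
  (∀ j, (S j).Nonempty) ∧ (∀ j k, j ≠ k → Disjoint (S j) (S k)) ∧
    Finset.univ.biUnion S = (Finset.univ : Finset (Fin d))

/-- `S` is the limiting partition of the stable sequence `w`. -/
def LimPart {d r : ℕ} (w : ℕ → Fin d → ℝ) (S : Fin r → Finset (Fin d)) : Prop :=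
  OrdPart S ∧
  (∀ i j : Fin d, (∃ a, i ∈ S a ∧ j ∈ S a) ↔
      ∃ L : ℝ, 0 < L ∧ Tendsto (fun n => w n i / w n j) atTop (𝓝 L)) ∧
  (∀ a b : Fin r, a < b → ∀ i ∈ S a, ∀ j ∈ S b,
      Tendsto (fun n => w n i / w n j) atTop atTop)

/-- The constant `C_i^T = ∏_{t ∈ T} (λ_t − λ_i)²`. -/
def Cc {d : ℕ} (lam : Fin d → ℝ) (i : Fin d) (T : Finset (Fin d)) : ℝ :=
  ∏ t ∈ T, (lam t - lam i) ^ 2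

/-- Offset `∑_{k<j} |S_k|` of the `j`-th block. -/
def offS {d r : ℕ} (S : Fin r → Finset (Fin d)) (j : Fin r) : ℕ :=
  ∑ k ∈ Finset.univ.filter (· < j), (S k).card

/-- The block-diagonal matrix whose `j`-th block (in rows/columns
`offS S j, …, offS S j + |S_j| - 1`) is `Jmat (restr (S j) lam) (restr (S j) (v j))`. -/
def blockDiag {d r : ℕ} (lam : Fin d → ℝ) (S : Fin r → Finset (Fin d))
    (v : Fin r → Fin d → ℝ) : Matrix (Fin d) (Fin d) ℝ :=
  Matrix.of fun p q =>
    ∑ j : Fin r,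
      if h : offS S j ≤ (p : ℕ) ∧ (p : ℕ) < offS S j + (S j).card ∧
          offS S j ≤ (q : ℕ) ∧ (q : ℕ) < offS S j + (S j).card then
        Jmat (restr (S j) lam) (restr (S j) (v j))
          ⟨(p : ℕ) - offS S j, by omega⟩ ⟨(q : ℕ) - offS S j, by omega⟩
      else 0

/-- Nonempty subsets of `Fin d`. -/
abbrev NES (d : ℕ) := {S : Finset (Fin d) // S.Nonempty}

/-- The ambient Euclidean space of families `(w^S)` indexed by nonempty subsets. -/
abbrev Ew (d : ℕ) := NES d → Fin d → ℝ

/-- The blow-up `B` (normalized representatives): support, nonnegativity,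
normalization, and the quadratic equations. -/
def Bset {d : ℕ} (lam : Fin d → ℝ) : Set (Ew d) :=
  {w | (∀ S : NES d, ∀ n, n ∉ S.1 → w S n = 0) ∧
    (∀ S n, 0 ≤ w S n) ∧
    (∀ S : NES d, ∑ n ∈ S.1, w S n = 1) ∧
    ∀ R S : NES d, R.1 ⊆ S.1 → ∀ i ∈ R.1, ∀ j ∈ R.1,
      Cc lam i (S.1 \ R.1) * w R j * w S i = Cc lam j (S.1 \ R.1) * w R i * w S j}

/-- `𝒥̄^Λ`: symmetric tridiagonal matrices with nonnegative off-diagonal entries and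
characteristic polynomial `∏ (X − λ_k)`. -/
def Jset {d : ℕ} (lam : Fin d → ℝ) : Set (Matrix (Fin d) (Fin d) ℝ) :=
  {J | (∀ i j, J i j = J j i) ∧
    (∀ i j : Fin d, (i : ℕ) + 2 ≤ (j : ℕ) ∨ (j : ℕ) + 2 ≤ (i : ℕ) → J i j = 0) ∧
    (∀ i j : Fin d, (i : ℕ) + 1 = (j : ℕ) → 0 ≤ J i j) ∧
    J.charpoly = ∏ k, (X - C (lam k))}

/-- `K_j = S_j ∪ S_{j+1} ∪ … ∪ S_r`. -/
def Kof {d r : ℕ} (S : Fin r → Finset (Fin d)) (j : Fin r) : Finset (Fin d) :=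
  (Finset.univ.filter (j ≤ ·)).biUnion S

/-- The piece `Z(P)` of `B` corresponding to the ordered partition `P = (S_1,…,S_r)`:
for every nonempty `T`, the support of `w^T` is `T ∩ S_{i(T,P)}`. -/
def Zset {d : ℕ} (lam : Fin d → ℝ) {r : ℕ} (S : Fin r → Finset (Fin d)) : Set (Ew d) :=
  {w | w ∈ Bset lam ∧ ∀ T : NES d, ∃ j : Fin r, T.1 ⊆ Kof S j ∧
    (∀ k, T.1 ⊆ Kof S k → k ≤ j) ∧ ∀ n : Fin d, w T n ≠ 0 ↔ n ∈ T.1 ∧ n ∈ S j}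

/-- `R ⪯ S`: the ordered partition `R` refines `S`, i.e. `R` is the concatenation of
ordered partitions of `S_1`, then `S_2`, etc. -/
def Refines {d q r : ℕ} (R : Fin q → Finset (Fin d)) (S : Fin r → Finset (Fin d)) : Prop :=
  ∃ b : Fin (r + 1) → ℕ, b 0 = 0 ∧ b (Fin.last r) = q ∧
    (∀ i j : Fin (r + 1), i ≤ j → b i ≤ b j) ∧
    ∀ i : Fin r, S i = (Finset.univ.filter
      (fun k : Fin q => b i.castSucc ≤ (k : ℕ) ∧ (k : ℕ) < b i.succ)).biUnion R

/-- The `j`-th consecutive interval `I_j(T)` of lengths `|T_1|,…,|T_r|`. -/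
def Iint {d r : ℕ} (T : Fin r → Finset (Fin d)) (j : Fin r) : Finset (Fin d) :=
  Finset.univ.filter (fun m : Fin d => offS T j ≤ (m : ℕ) ∧ (m : ℕ) < offS T j + (T j).card)

/-- `H(T) = {σ : σ(T_j) = I_j(T) for all j}`. -/
def Hset {d r : ℕ} (T : Fin r → Finset (Fin d)) : Set (Equiv.Perm (Fin d)) :=
  {σ | ∀ j, (T j).image σ = Iint T j}

/-- Interval Young subgroups: setwise stabilizers of a division of `{0,…,d-1}` into
consecutive intervals. -/
def IsIntervalYoung {d : ℕ} (G : Set (Equiv.Perm (Fin d))) : Prop :=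
  ∃ (q : ℕ) (c : Fin q → Finset (Fin d)), OrdPart c ∧ (∀ j : Fin q, c j = Iint c j) ∧
    G = {τ : Equiv.Perm (Fin d) | ∀ j, (c j).image ⇑τ = c j}

/-- Number of surjections from an `a`-element set onto a `b`-element set. -/
def Surj (a b : ℕ) : ℕ := Fintype.card {f : Fin a → Fin b // Function.Surjective f}

/-- The Euler characteristic `χ_d = ∑_{q=1}^d (−2)^{d−q}·Surj(d,q)`. -/
def chi (a : ℕ) : ℝ := ∑ q ∈ Finset.Icc 1 a, (-2 : ℝ) ^ (a - q) * (Surj a q : ℝ)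

lemma Cc_pos {d : ℕ} {lam : Fin d → ℝ} (hlam : Function.Injective lam) {i : Fin d}
    {T : Finset (Fin d)} (hi : i ∉ T) : 0 < Cc lam i T := by
  refine Finset.prod_pos fun t ht => ?_
  have h : lam t - lam i ≠ 0 := sub_ne_zero.2 fun h => hi (hlam h ▸ ht)
  positivity

lemma Cc_mul_of_disjoint {d : ℕ} (lam : Fin d → ℝ) (i : Fin d) {S T : Finset (Fin d)}
    (h : Disjoint S T) : Cc lam i (S ∪ T) = Cc lam i S * Cc lam i T :=
  Finset.prod_union h

/-- The weights on `T` induced by the weight vector `v` on `K`: proportional to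
`C_n^{K ∖ T} vₙ` and of total mass one. -/
def inducedWeight {d : ℕ} (lam : Fin d → ℝ) (K T : Finset (Fin d)) (v : Fin d → ℝ)
    (n : Fin d) : ℝ :=
  Cc lam n (K \ T) * v n / ∑ k ∈ T, Cc lam k (K \ T) * v k

lemma sum_Cc_mul_pos {d : ℕ} {lam : Fin d → ℝ} (hlam : Function.Injective lam)
    {K T : Finset (Fin d)} {v : Fin d → ℝ} (hv : ∀ n ∈ T, 0 ≤ v n) {i : Fin d} (hi : i ∈ T)
    (hvi : 0 < v i) : 0 < ∑ k ∈ T, Cc lam k (K \ T) * v k := by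
  have hC : ∀ n ∈ T, 0 < Cc lam n (K \ T) := fun n hn => Cc_pos hlam (by simp [hn])
  exact Finset.sum_pos' (fun n hn => mul_nonneg (hC n hn).le (hv n hn))
    ⟨i, hi, mul_pos (hC i hi) hvi⟩

lemma isClosed_Bset {d : ℕ} (lam : Fin d → ℝ) : IsClosed (Bset lam) := by
  simp only [Bset, Set.ofPred_and, Set.ofPred_forall]
  refine IsClosed.inter ?_ (IsClosed.inter ?_ (IsClosed.inter ?_ ?_))
  · exact isClosed_iInter fun S => isClosed_iInter fun n => isClosed_iInter fun _ =>
      isClosed_eq (by fun_prop) (by fun_prop)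
  · exact isClosed_iInter fun S => isClosed_iInter fun n =>
      isClosed_le (by fun_prop) (by fun_prop)
  · exact isClosed_iInter fun S => isClosed_eq (by fun_prop) (by fun_prop)
  · exact isClosed_iInter fun R => isClosed_iInter fun S => isClosed_iInter fun _ =>
      isClosed_iInter fun i => isClosed_iInter fun _ => isClosed_iInter fun j =>
      isClosed_iInter fun _ => isClosed_eq (by fun_prop) (by fun_prop)

/-- In a point of `B`, the weights on `K` determine those on every subset `T` that meets
their support. -/
lemma inducedWeight_eq_of_mem_Bset {d : ℕ} {lam : Fin d → ℝ} (hlam : Function.Injective lam)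
    {w : Ew d} (hw : w ∈ Bset lam) {K T : NES d} (hTK : T.1 ⊆ K.1) {i : Fin d} (hi : i ∈ T.1)
    (hwi : w K i ≠ 0) {n : Fin d} (hn : n ∈ T.1) :
    inducedWeight lam K.1 T.1 (w K) n = w T n := by
  obtain ⟨-, hnonneg, hsum, heq⟩ := hw
  have hpos := sum_Cc_mul_pos hlam (K := K.1) (fun n _ => hnonneg K n) hi
    ((hnonneg K i).lt_of_ne' hwi)
  rw [inducedWeight, div_eq_iff hpos.ne', Finset.mul_sum]
  calc Cc lam n (K.1 \ T.1) * w K n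
      = ∑ j ∈ T.1, Cc lam n (K.1 \ T.1) * w T j * w K n := by
        rw [← Finset.sum_mul, ← Finset.mul_sum, hsum T, mul_one]
    _ = ∑ j ∈ T.1, w T n * (Cc lam j (K.1 \ T.1) * w K j) :=
        Finset.sum_congr rfl fun j hj => by rw [heq T K hTK n hn j hj]; ring

/-- A positive weight vector induces a point of the principal part of `B`. -/
lemma inducedWeight_mem_principal {d : ℕ} {lam : Fin d → ℝ} (hlam : Function.Injective lam)
    {v : Fin d → ℝ} (hv : ∀ n, 0 < v n) :
    (fun (S : NES d) n => if n ∈ S.1 then inducedWeight lam Finset.univ S.1 v n else 0) ∈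
      {w : Ew d | w ∈ Bset lam ∧ ∀ S : NES d, ∀ n ∈ S.1, 0 < w S n} := by
  have hden : ∀ S : NES d, 0 < ∑ k ∈ S.1, Cc lam k (Finset.univ \ S.1) * v k := fun S =>
    sum_Cc_mul_pos hlam (fun n _ => (hv n).le) S.2.choose_spec (hv _)
  have hpos : ∀ S : NES d, ∀ n ∈ S.1, 0 < inducedWeight lam Finset.univ S.1 v n := fun S n hn =>
    div_pos (mul_pos (Cc_pos hlam (by simp [hn])) (hv n)) (hden S)
  refine ⟨⟨fun S n hn => if_neg hn, fun S n => ?_, fun S => ?_, ?_⟩, fun S n hn => ?_⟩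
  · dsimp only
    split_ifs with hn
    exacts [(hpos S n hn).le, le_rfl]
  · rw [Finset.sum_congr rfl fun n hn => if_pos hn]
    exact (Finset.sum_div _ _ _).symm.trans (div_self (hden S).ne')
  · intro R S hRS i hi j hj
    have hC : ∀ k, Cc lam k (Finset.univ \ R.1) =
        Cc lam k (S.1 \ R.1) * Cc lam k (Finset.univ \ S.1) := fun k => by
      rw [← Cc_mul_of_disjoint]
      · congr 1
        grind
      · exact Finset.disjoint_left.2 (by grind)
    simp only [hi, hj, hRS hi, hRS hj, if_true, inducedWeight]
    rw [hC i, hC j]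
    ring
  · simpa only [if_pos hn] using hpos S n hn

/-- For a point `w` of `B` and a set `K`, there is a sequence of positive weight vectors
whose induced weights on all nonempty subsets of `K` converge to those of `w`. -/
lemma exists_tendsto_inducedWeight {d : ℕ} {lam : Fin d → ℝ} (hlam : Function.Injective lam)
    {w : Ew d} (hw : w ∈ Bset lam) (K : Finset (Fin d)) :
    ∃ u : ℕ → Fin d → ℝ, (∀ k n, 0 < u k n) ∧
      (∀ n, ∃ L, Tendsto (fun k => u k n) atTop (𝓝 L)) ∧
      ∀ T : NES d, T.1 ⊆ K → ∀ n ∈ T.1,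
        Tendsto (fun k => inducedWeight lam K T.1 (u k) n) atTop (𝓝 (w T n)) := by
  induction K using Finset.strongInduction with
  | H K ih =>
  rcases K.eq_empty_or_nonempty with rfl | hK
  · exact ⟨fun _ _ => 1, fun _ _ => one_pos, fun _ => ⟨1, tendsto_const_nhds⟩,
      fun T hT => absurd T.2 (by simp [Finset.subset_empty.1 hT])⟩
  obtain ⟨K, rfl⟩ : ∃ K' : NES d, K'.1 = K := ⟨⟨K, hK⟩, rfl⟩
  obtain ⟨-, hnonneg, hsum, -⟩ := id hw
  set S := K.1.filter (fun n => w K n ≠ 0) with hS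
  have hSne : S.Nonempty := by
    obtain ⟨i, hi, hwi⟩ := Finset.exists_ne_zero_of_sum_ne_zero
      (by rw [hsum K]; exact one_ne_zero : ∑ n ∈ K.1, w K n ≠ 0)
    exact ⟨i, by simp [hS, hi, hwi]⟩
  have hSK : S ⊆ K.1 := Finset.filter_subset _ _
  obtain ⟨u, hu, hlim, hind⟩ := ih (K.1 \ S) (Finset.sdiff_ssubset hSK hSne)
  choose L hL using hlim
  set v : ℕ → Fin d → ℝ := fun k n =>
    if w K n ≠ 0 then w K n else 1 / ((k : ℝ) + 1) * (u k n / Cc lam n S) with hv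
  have hvlim : ∀ n, Tendsto (fun k => v k n) atTop (𝓝 (w K n)) := fun n => by
    by_cases hn : w K n = 0
    · simpa [hv, hn] using
        tendsto_one_div_add_atTop_nhds_zero_nat.mul ((hL n).div_const (Cc lam n S))
    · simp [hv, hn]
  refine ⟨v, fun k n => ?_, fun n => ⟨_, hvlim n⟩, fun T hT n hn => ?_⟩
  · change 0 < ite _ _ _
    split_ifs with h
    · exact (hnonneg K n).lt_of_ne' h
    · have := Cc_pos hlam (i := n) (T := S) (by simp_all)
      have := hu k n
      positivity
  · by_cases hmeet : ∃ i ∈ T.1, w K i ≠ 0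
    · obtain ⟨i, hi, hwi⟩ := hmeet
      rw [← inducedWeight_eq_of_mem_Bset hlam hw hT hi hwi hn]
      have hpos := sum_Cc_mul_pos hlam (K := K.1) (fun n _ => hnonneg K n) hi
        ((hnonneg K i).lt_of_ne' hwi)
      exact ((hvlim n).const_mul _).div
        (tendsto_finsetSum _ fun j _ => (hvlim j).const_mul _) hpos.ne'
    · push Not at hmeet
      have hTS : T.1 ⊆ K.1 \ S := fun j hj => by simp [hS, hT hj, hmeet j hj]
      refine (hind T hTS n hn).congr fun k => ?_
      have hscale : ∀ j ∈ T.1, Cc lam j (K.1 \ T.1) * v k j =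
          1 / ((k : ℝ) + 1) * (Cc lam j ((K.1 \ S) \ T.1) * u k j) := fun j hj => by
        have hsplit : K.1 \ T.1 = S ∪ ((K.1 \ S) \ T.1) := by grind
        have hC := (Cc_pos hlam (Finset.mem_sdiff.1 (hTS hj)).2).ne'
        rw [hsplit, Cc_mul_of_disjoint lam j (Finset.disjoint_left.2 (by grind))]
        simp only [hv, hmeet j hj, ne_eq, not_true_eq_false, if_false]
        field_simp
      rw [inducedWeight, inducedWeight, hscale n hn, Finset.sum_congr rfl hscale,
        ← Finset.mul_sum, mul_div_mul_left _ _ (by positivity)]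

/-- Proposition 10: `B` is the closure of its principal part `B°`. -/
theorem stmt12 {d : ℕ} (hd : 1 ≤ d) (lam : Fin d → ℝ) (hlam : Function.Injective lam) :
    Bset lam = closure {w : Ew d | w ∈ Bset lam ∧ ∀ S : NES d, ∀ n ∈ S.1, 0 < w S n} := by
  refine Set.Subset.antisymm (fun w hw => ?_)
    (closure_minimal (fun w hw => hw.1) (isClosed_Bset lam))
  obtain ⟨u, hu, -, hind⟩ := exists_tendsto_inducedWeight hlam hw Finset.univ
  refine mem_closure_of_tendsto (b := atTop) ?_
    (Eventually.of_forall fun k => inducedWeight_mem_principal hlam (hu k))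
  refine tendsto_pi_nhds.2 fun S => tendsto_pi_nhds.2 fun n => ?_
  by_cases hn : n ∈ S.1
  · simpa only [if_pos hn] using hind S (Finset.subset_univ _) n hn
  · simp [hn, hw.1 S n hn]
end
end

section
/- For every w ∈ (0,∞)^d and every n with 0 ≤ n ≤ d, the polynomial p_n of the recursion equals the characteristic polynomial of the leading n×n principal submatrix of f(λ,w) (with the convention that the characteristic polynomial of the 0×0 matrix is 1). In particular, the characteristic polynomial of f(λ,w) equals p_d = Π_{k=1}^d (X − λ_k), so the spectrum of f(λ,w) is {λ_1,…,λ_d}. -/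
noncomputable section
open Polynomial Filter Topology ENNReal

/-! ### Determinants of tridiagonal matrices -/

/-- The three-term recurrence for leading principal minors of a tridiagonal array. -/
lemma det_tridiagonal_succ_succ {R : Type*} [CommRing R] (M : ℕ → ℕ → R)
    (hM : ∀ i j, i + 2 ≤ j ∨ j + 2 ≤ i → M i j = 0) (n : ℕ) :
    (Matrix.of fun i j : Fin (n + 2) => M i j).det =
      M (n + 1) (n + 1) * (Matrix.of fun i j : Fin (n + 1) => M i j).det -
        M (n + 1) n * M n (n + 1) * (Matrix.of fun i j : Fin n => M i j).det := by
  have minor : ((Matrix.of fun i j : Fin (n + 2) => M i j).submatrix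
      (Fin.last (n + 1)).succAbove (Fin.last n).castSucc.succAbove).det =
        M n (n + 1) * (Matrix.of fun i j : Fin n => M i j).det := by
    rw [Matrix.det_succ_column _ (Fin.last n), Fin.sum_univ_castSucc,
      Finset.sum_eq_zero, zero_add]
    · have h : (Matrix.of fun i j : Fin n => M i j) =
          ((Matrix.of fun i j : Fin (n + 2) => M i j).submatrix (Fin.last (n + 1)).succAbove
            (Fin.last n).castSucc.succAbove).submatrix
              (Fin.last n).succAbove (Fin.last n).succAbove := by
        ext i j
        simp [Fin.succAbove_castSucc_of_lt _ _ (Fin.castSucc_lt_last j)]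
      rw [← h]
      simp [← two_mul]
    · intro i _
      simp only [Matrix.submatrix_apply, Matrix.of_apply]
      rw [hM]
      · ring
      · left
        simp
  rw [Matrix.det_succ_row _ (Fin.last (n + 1)), Fin.sum_univ_castSucc, Fin.sum_univ_castSucc,
    Finset.sum_eq_zero, zero_add, minor]
  · have h : (Matrix.of fun i j : Fin (n + 1) => M i j) =
        (Matrix.of fun i j : Fin (n + 2) => M i j).submatrix
          (Fin.last (n + 1)).succAbove (Fin.last (n + 1)).succAbove := by
      ext i j
      simp
    rw [← h]
    have e : (-1 : R) ^ (n + 1 + n) = -1 := Odd.neg_one_pow ⟨n, by ring⟩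
    have e' : (-1 : R) ^ (n + 1 + (n + 1)) = 1 := Even.neg_one_pow ⟨n + 1, rfl⟩
    simp [e, e']
    ring
  · intro j _
    simp only [Matrix.of_apply]
    rw [hM]
    · ring
    · right
      simp

/-! ### The bilinear form -/

section ip
variable {m : ℕ} (μ v : Fin m → ℝ)

lemma ip_comm (p q : ℝ[X]) : ip μ v p q = ip μ v q p := by
  simp only [ip, mul_comm]

lemma ip_add_right (p q r : ℝ[X]) : ip μ v p (q + r) = ip μ v p q + ip μ v p r := by
  simp only [ip, eval_add, mul_add, add_mul, Finset.sum_add_distrib]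

lemma ip_sub_left (p q r : ℝ[X]) : ip μ v (p - q) r = ip μ v p r - ip μ v q r := by
  simp only [ip, eval_sub, sub_mul, Finset.sum_sub_distrib]

lemma ip_C_mul_left (c : ℝ) (p q : ℝ[X]) : ip μ v (C c * p) q = c * ip μ v p q := by
  simp only [ip, eval_mul, eval_C, Finset.mul_sum, mul_assoc]

lemma ip_C_mul_right (c : ℝ) (p q : ℝ[X]) : ip μ v p (C c * q) = c * ip μ v p q := by
  rw [ip_comm, ip_C_mul_left, ip_comm]

lemma ip_X_mul_left (p q : ℝ[X]) : ip μ v (X * p) q = ip μ v p (X * q) := by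
  simp only [ip, eval_mul, eval_X]
  exact Finset.sum_congr rfl fun _ _ => by ring

variable {μ v}

lemma ip_self_nonneg (hv : ∀ k, 0 < v k) (p : ℝ[X]) : 0 ≤ ip μ v p p :=
  Finset.sum_nonneg fun k _ => mul_nonneg (mul_self_nonneg _) (hv k).le

lemma eq_zero_of_ip_self_eq_zero (hμ : Function.Injective μ) (hv : ∀ k, 0 < v k) {p : ℝ[X]}
    (hp : p.degree < m) (h : ip μ v p p = 0) : p = 0 := by
  refine eq_zero_of_degree_lt_of_eval_index_eq_zero (s := Finset.univ) (v := μ) hμ.injOn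
    (by simpa using hp) fun k hk => ?_
  have := (Finset.sum_eq_zero_iff_of_nonneg fun k _ =>
    mul_nonneg (mul_self_nonneg (p.eval (μ k))) (hv k).le).1 h k hk
  simpa [(hv k).ne'] using this

end ip

lemma Polynomial.Monic.exists_eq_C_mul_add {R : Type*} [CommRing R] {p q : R[X]} {n : ℕ}
    (hp : p.Monic) (hn : p.natDegree = n) (hq : q.degree < (n + 1 : ℕ)) :
    ∃ (c : R) (r : R[X]), q = C c * p + r ∧ r.degree < n := by
  refine ⟨q.coeff n, q - C (q.coeff n) * p, by ring, ?_⟩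
  rw [degree_lt_iff_coeff_zero] at hq ⊢
  intro k hk
  rw [coeff_sub, coeff_C_mul]
  rcases hk.eq_or_lt with rfl | hk
  · have : p.coeff n = 1 := by rw [← hn]; exact hp
    simp [this]
  · rw [hq k hk, coeff_eq_zero_of_natDegree_lt (hn.trans_lt hk)]
    simp

/-! ### Orthogonal polynomials -/

section op
variable {m : ℕ} (μ v : Fin m → ℝ)

lemma op_zero : op μ v 0 = 1 := rfl

lemma op_one : op μ v 1 = X - C (fEnt μ v 1) := by
  simp [op, opAux, fEnt]

lemma op_succ_succ' (n : ℕ) : op μ v (n + 2) =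
    (X - C (ip μ v (op μ v (n + 1)) (X * op μ v (n + 1)) /
        ip μ v (op μ v (n + 1)) (op μ v (n + 1)))) * op μ v (n + 1) -
      C (ip μ v (op μ v (n + 1)) (op μ v (n + 1)) / ip μ v (op μ v n) (op μ v n)) *
        op μ v n := rfl

variable {μ v} in
lemma op_succ_succ (hv : ∀ k, 0 < v k) (n : ℕ) : op μ v (n + 2) =
    (X - C (fEnt μ v (2 * (n + 1) + 1))) * op μ v (n + 1) -
      C (fEnt μ v (2 * (n + 1)) ^ 2) * op μ v n := by
  have h1 : (2 * (n + 1) + 1) / 2 = n + 1 := by omega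
  have h2 : 2 * (n + 1) / 2 = n + 1 := by omega
  have h3 : (2 * (n + 1) + 1) % 2 = 1 := by omega
  have h4 : ¬ 2 * (n + 1) % 2 = 1 := by omega
  rw [op_succ_succ', fEnt, fEnt, if_pos h3, if_neg h4, h1, h2, Nat.add_sub_cancel,
    Real.sq_sqrt (div_nonneg (ip_self_nonneg hv _) (ip_self_nonneg hv _))]

lemma op_monic_natDegree (n : ℕ) : (op μ v n).Monic ∧ (op μ v n).natDegree = n := by
  induction n using Nat.twoStepInduction with
  | zero => simp [op_zero]
  | one => rw [op_one]; exact ⟨monic_X_sub_C _, natDegree_X_sub_C _⟩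
  | more n ih0 ih1 =>
    rw [op_succ_succ']
    generalize ip μ v (op μ v (n + 1)) (X * op μ v (n + 1)) /
        ip μ v (op μ v (n + 1)) (op μ v (n + 1)) = a
    generalize ip μ v (op μ v (n + 1)) (op μ v (n + 1)) / ip μ v (op μ v n) (op μ v n) = b
    have hm : ((X - C a) * op μ v (n + 1)).Monic := (monic_X_sub_C a).mul ih1.1
    have hd : ((X - C a) * op μ v (n + 1)).natDegree = n + 2 := by
      rw [(monic_X_sub_C a).natDegree_mul ih1.1, natDegree_X_sub_C, ih1.2]
      ring
    have hlt : (C b * op μ v n).natDegree < ((X - C a) * op μ v (n + 1)).natDegree := by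
      have := natDegree_C_mul_le b (op μ v n)
      omega
    exact ⟨hm.sub_of_left (degree_lt_degree hlt),
      by rw [natDegree_sub_eq_left_of_natDegree_lt hlt, hd]⟩

lemma op_monic (n : ℕ) : (op μ v n).Monic := (op_monic_natDegree μ v n).1

lemma natDegree_op (n : ℕ) : (op μ v n).natDegree = n := (op_monic_natDegree μ v n).2

lemma degree_op (n : ℕ) : (op μ v n).degree = n := by
  rw [degree_eq_natDegree (op_monic μ v n).ne_zero, natDegree_op]

variable {μ v}

lemma ip_op_self_ne_zero (hμ : Function.Injective μ) (hv : ∀ k, 0 < v k) {n : ℕ} (hn : n < m) :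
    ip μ v (op μ v n) (op μ v n) ≠ 0 := fun h =>
  (op_monic μ v n).ne_zero <| eq_zero_of_ip_self_eq_zero hμ hv
    (by rw [degree_op]; exact_mod_cast hn) h

lemma ip_op_eq_zero (hμ : Function.Injective μ) (hv : ∀ k, 0 < v k) (n : ℕ) :
    n ≤ m → ∀ q : ℝ[X], q.degree < n → ip μ v (op μ v n) q = 0 := by
  induction n using Nat.twoStepInduction with
  | zero =>
    intro _ q hq
    have : q = 0 := by simpa using hq
    simp [this, ip]
  | one =>
    intro h q hq
    obtain ⟨c, r, rfl, hr⟩ := (op_monic μ v 0).exists_eq_C_mul_add (natDegree_op μ v 0) hq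
    have : r = 0 := by simpa using hr
    have h0 := ip_op_self_ne_zero hμ hv (n := 0) h
    have e : fEnt μ v 1 = ip μ v (op μ v 0) (X * op μ v 0) / ip μ v (op μ v 0) (op μ v 0) := rfl
    rw [this, add_zero, ip_C_mul_right, op_one,
      show (X - C (fEnt μ v 1) : ℝ[X]) = X * op μ v 0 - C (fEnt μ v 1) * op μ v 0 by simp [op_zero],
      ip_sub_left, ip_C_mul_left, ip_X_mul_left, e, div_mul_cancel₀ _ h0, sub_self, mul_zero]
  | more n ih0 ih1 =>
    intro h q hq
    have orth1 := ih1 (by omega)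
    have orth0 := ih0 (by omega)
    have h0 := ip_op_self_ne_zero hμ hv (n := n) (by omega)
    have h1 := ip_op_self_ne_zero hμ hv (n := n + 1) (by omega)
    obtain ⟨c, r, rfl, hr⟩ :=
      (op_monic μ v (n + 1)).exists_eq_C_mul_add (natDegree_op μ v (n + 1)) hq
    obtain ⟨c', s, rfl, hs⟩ := (op_monic μ v n).exists_eq_C_mul_add (natDegree_op μ v n) hr
    have hXs : (X * s : ℝ[X]).degree < (n + 1 : ℕ) := by
      rw [degree_lt_iff_coeff_zero] at hs ⊢
      rintro (_ | k) hk
      · omega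
      · rw [coeff_X_mul]; exact hs k (by omega)
    have hXp : ip μ v (op μ v (n + 1)) (X * op μ v n) =
        ip μ v (op μ v (n + 1)) (op μ v (n + 1)) := by
      have hX : (X * op μ v n : ℝ[X]).degree < (n + 1 + 1 : ℕ) := by
        rw [degree_mul, degree_X, degree_op]
        norm_cast
        omega
      obtain ⟨e, t, he, ht⟩ :=
        (op_monic μ v (n + 1)).exists_eq_C_mul_add (natDegree_op μ v (n + 1)) hX
      have hc := congrArg (fun f => coeff f (n + 1)) he
      have hpn : (op μ v n).coeff n = 1 := by
        simpa [natDegree_op] using (op_monic μ v n).coeff_natDegree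
      have hpn1 : (op μ v (n + 1)).coeff (n + 1) = 1 := by
        simpa [natDegree_op] using (op_monic μ v (n + 1)).coeff_natDegree
      simp only [coeff_X_mul, coeff_add, coeff_C_mul, hpn, hpn1,
        coeff_eq_zero_of_degree_lt ht] at hc
      rw [he, ip_add_right, ip_C_mul_right, orth1 t ht]
      linear_combination -hc * ip μ v (op μ v (n + 1)) (op μ v (n + 1))
    have hp0 : ip μ v (op μ v (n + 1)) (op μ v n) = 0 :=
      orth1 _ (by rw [degree_op]; exact_mod_cast n.lt_succ_self)
    have hs1 : ip μ v (op μ v (n + 1)) s = 0 :=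
      orth1 _ (hs.trans (by exact_mod_cast n.lt_succ_self))
    have hp0' : ip μ v (op μ v n) (op μ v (n + 1)) = 0 := by rw [ip_comm, hp0]
    rw [op_succ_succ', sub_mul]
    simp only [ip_sub_left, ip_C_mul_left, ip_X_mul_left,
      ip_add_right, ip_C_mul_right, orth0 s hs, orth1 _ hXs, hXp, hp0, hp0', hs1]
    field_simp
    ring

lemma op_eq_prod (hμ : Function.Injective μ) (hv : ∀ k, 0 < v k) :
    op μ v m = ∏ k, (X - C (μ k)) := by
  have hP : (∏ k, (X - C (μ k))).Monic := monic_prod_of_monic _ _ fun k _ => monic_X_sub_C _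
  have hPd : (∏ k, (X - C (μ k)) : ℝ[X]).degree = m := by
    rw [degree_prod]; simp
  have hlt : (op μ v m - ∏ k, (X - C (μ k))).degree < m := by
    rw [← degree_op μ v m]
    exact degree_sub_lt_left (by rw [degree_op, hPd]) (op_monic μ v m).ne_zero
      (by rw [(op_monic μ v m).leadingCoeff, hP.leadingCoeff])
  refine sub_eq_zero.1 (eq_zero_of_ip_self_eq_zero hμ hv hlt ?_)
  rw [ip_sub_left, ip_op_eq_zero hμ hv m le_rfl _ hlt, zero_sub, neg_eq_zero]
  refine Finset.sum_eq_zero fun k _ => ?_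
  rw [eval_prod, Finset.prod_eq_zero (Finset.mem_univ k) (by simp)]
  simp

/-! ### The Jacobi matrix -/

variable (μ v) in
/-- The characteristic matrix of `Jmat μ v`, extended to an infinite array. -/
def charArray (i j : ℕ) : ℝ[X] :=
  if i = j then X - C (fEnt μ v (2 * i + 1))
  else if i + 1 = j ∨ j + 1 = i then -C (fEnt μ v (i + j + 1))
  else 0

lemma charpoly_leadSub_Jmat (n : ℕ) (h : n ≤ m) :
    (leadSub (Jmat μ v) n h).charpoly = (Matrix.of fun i j : Fin n => charArray μ v i j).det := by
  rw [Matrix.charpoly]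
  congr 1
  ext1 i j
  rw [Matrix.charmatrix_apply]
  by_cases hij : i = j
  · simp [hij, leadSub, Jmat, charArray]
  · have hij' : (i : ℕ) ≠ j := fun e => hij (Fin.ext e)
    by_cases hb : (i : ℕ) + 1 = j ∨ (j : ℕ) + 1 = i <;>
      simp [hij, hij', hb, leadSub, Jmat, charArray]

lemma op_eq_det_charArray (hv : ∀ k, 0 < v k) (n : ℕ) :
    op μ v n = (Matrix.of fun i j : Fin n => charArray μ v i j).det := by
  induction n using Nat.twoStepInduction with
  | zero => simp [op_zero]
  | one => simp [op_one, charArray]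
  | more n ih0 ih1 =>
    rw [det_tridiagonal_succ_succ, ← ih0, ← ih1, op_succ_succ hv]
    · have e : n + 1 + n + 1 = 2 * (n + 1) := by ring
      have e' : n + (n + 1) + 1 = 2 * (n + 1) := by ring
      simp only [charArray, n.succ_ne_self, n.succ_ne_self.symm, if_true, if_false, or_true,
        true_or, e, e', map_pow]
      ring
    · intro i j hij
      rw [charArray, if_neg (by omega), if_neg (by omega)]

end op

/-- `p_n` is the characteristic polynomial of the leading `n×n`
submatrix of `f(λ,w)`; in particular the spectrum of `f(λ,w)` is `{λ_1,…,λ_d}`. -/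
theorem stmt19 {d : ℕ} (hd : 1 ≤ d) (lam : Fin d → ℝ) (hlam : Function.Injective lam)
    (w : Fin d → ℝ) (hw : ∀ k, 0 < w k) :
    (∀ (i : ℕ) (h : i ≤ d), op lam w i = (leadSub (Jmat lam w) i h).charpoly) ∧
    (Jmat lam w).charpoly = ∏ k, (X - C (lam k)) ∧
    spectrum ℝ (Jmat lam w) = Set.range lam := by
  have hop (i : ℕ) (h : i ≤ d) : op lam w i = (leadSub (Jmat lam w) i h).charpoly := by
    rw [charpoly_leadSub_Jmat, op_eq_det_charArray hw]
  have hchar : (Jmat lam w).charpoly = ∏ k, (X - C (lam k)) := by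
    rw [← op_eq_prod hlam hw]
    exact (hop d le_rfl).symm
  refine ⟨hop, hchar, Set.ext fun x => ?_⟩
  rw [Matrix.mem_spectrum_iff_isRoot_charpoly, hchar, IsRoot, eval_prod, Finset.prod_eq_zero_iff]
  simp [sub_eq_zero, eq_comm]
end
end
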